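/- arXiv:2202.10678 — 7 statements merged into one kernel-verified Lean document; each statement's English description precedes it below -/
import Mathlib

section
/- Suppose the prior μ is (p₀,D)-regular with respect to u, π* is a signaling scheme persuasive for μ, π⁰ is a full-revelation scheme, and ε > 0 is such that δ := ε/(p₀·D) ≤ 1. Then the mixed scheme π' defined pointwise by π'(a|ω) = (1−δ)π*(a|ω) + δπ⁰(a|ω) is persuasive for every prior μ̃ with ‖μ̃ − μ‖₁ ≤ ε. -/
open Finset
open scoped Classical

/-- A prior is a probability mass function on the finite outcome space. -/
def IsPrior {Ω : Type*} [Fintype Ω] (μ : Ω → ℝ) : Prop :=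
  (∀ ω, 0 ≤ μ ω) ∧ ∑ ω, μ ω = 1

/-- A signaling scheme assigns to each outcome a probability mass function on actions. -/
def IsScheme {Ω A : Type*} [Fintype A] (π : Ω → A → ℝ) : Prop :=
  (∀ ω a, 0 ≤ π ω a) ∧ ∀ ω, ∑ a, π ω a = 1

/-- Persuasiveness of a scheme `π` for a prior `μ` with respect to receiver utility `u`. -/
def Persuasive {Ω A : Type*} [Fintype Ω] [Fintype A]
    (u : Ω → A → ℝ) (μ : Ω → ℝ) (π : Ω → A → ℝ) : Prop :=
  ∀ a a', 0 ≤ ∑ ω, μ ω * π ω a * (u ω a - u ω a')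

/-- A full-revelation scheme: for every outcome, the scheme is supported on actions
maximizing the receiver's utility at that outcome. -/
def FullRevelation {Ω A : Type*} [Fintype A]
    (u : Ω → A → ℝ) (π : Ω → A → ℝ) : Prop :=
  ∀ ω a, π ω a ≠ 0 → ∀ a', u ω a' ≤ u ω a

/-- The ℓ₁ distance between two priors. -/
def l1dist {Ω : Type*} [Fintype Ω] (μ ν : Ω → ℝ) : ℝ :=
  ∑ ω, |μ ω - ν ω|

/-- The set `W_a(D)` of outcomes where action `a` beats every other action by at least `D`. -/
noncomputable def Wset {Ω A : Type*} [Fintype Ω] [Fintype A]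
    (u : Ω → A → ℝ) (a : A) (D : ℝ) : Finset Ω :=
  Finset.univ.filter (fun ω => ∀ a' ≠ a, u ω a' + D ≤ u ω a)

/-- `(p₀, D)`-regularity of a prior `μ` with respect to receiver utility `u`. -/
def Regular {Ω A : Type*} [Fintype Ω] [Fintype A]
    (u : Ω → A → ℝ) (μ : Ω → ℝ) (p₀ D : ℝ) : Prop :=
  ∀ a : A, p₀ ≤ ∑ ω ∈ Wset u a D, μ ω

theorem stmt2 {Ω A : Type*} [Fintype Ω] [Nonempty Ω] [Fintype A]
    (hA : 2 ≤ Fintype.card A)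
    (u : Ω → A → ℝ) (hu : ∀ ω a, u ω a ∈ Set.Icc (0 : ℝ) 1)
    (p₀ D : ℝ) (hp₀ : p₀ ∈ Set.Ioc (0 : ℝ) 1) (hD : D ∈ Set.Ioc (0 : ℝ) 1)
    (μ : Ω → ℝ) (hμ : IsPrior μ) (hreg : Regular u μ p₀ D)
    (πs : Ω → A → ℝ) (hπs : IsScheme πs) (hpers : Persuasive u μ πs)
    (π0 : Ω → A → ℝ) (hπ0 : IsScheme π0) (hfull : FullRevelation u π0)
    (ε : ℝ) (hε : 0 < ε) (hδ : ε / (p₀ * D) ≤ 1) :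
    ∀ μ' : Ω → ℝ, IsPrior μ' → l1dist μ' μ ≤ ε →
      Persuasive u μ'
        (fun ω a => (1 - ε / (p₀ * D)) * πs ω a + (ε / (p₀ * D)) * π0 ω a) := by
  intro μ' hμ' hl a a'
  have hp := hp₀.1
  have hd := hD.1
  have hpd : 0 < p₀ * D := mul_pos hp hd
  by_cases haa : a' = a
  · subst haa; simp
  obtain ⟨δ, hδe⟩ : ∃ δ, δ = ε / (p₀ * D) := ⟨_, rfl⟩
  have hδε : δ * (p₀ * D) = ε := by rw [hδe]; field_simp
  have hδ0 : 0 ≤ δ := by rw [hδe]; positivity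
  rw [← hδe] at hδ
  simp only [← hδe]
  have le1 : ∀ π : Ω → A → ℝ, IsScheme π → ∀ ω, π ω a ≤ 1 := fun π h ω => by
    rw [← h.2 ω]
    exact Finset.single_le_sum (f := fun b => π ω b) (fun b _ => h.1 ω b) (Finset.mem_univ a)
  have hterm0 : ∀ ω, 0 ≤ μ ω * π0 ω a * (u ω a - u ω a') := by
    intro ω
    by_cases h : π0 ω a = 0
    · simp [h]
    · exact mul_nonneg (mul_nonneg (hμ.1 ω) (hπ0.1 ω a)) (sub_nonneg.2 (hfull ω a h a'))
  have hW : ∀ ω ∈ Wset u a D, μ ω * D ≤ μ ω * π0 ω a * (u ω a - u ω a') := by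
    intro ω hω
    have hω' : ∀ b ≠ a, u ω b + D ≤ u ω a := by simpa [Wset] using hω
    have h1 : π0 ω a = 1 := by
      rw [← hπ0.2 ω]
      symm
      apply Finset.sum_eq_single a
      · intro b _ hb
        by_contra h
        have := hfull ω b h a
        have := hω' b hb
        linarith
      · simp
    rw [h1, mul_one]
    exact mul_le_mul_of_nonneg_left (by linarith [hω' a' haa]) (hμ.1 ω)
  have hS0 : p₀ * D ≤ ∑ ω, μ ω * π0 ω a * (u ω a - u ω a') := by
    calc p₀ * D ≤ (∑ ω ∈ Wset u a D, μ ω) * D := mul_le_mul_of_nonneg_right (hreg a) hd.le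
      _ = ∑ ω ∈ Wset u a D, μ ω * D := Finset.sum_mul _ _ _
      _ ≤ ∑ ω ∈ Wset u a D, μ ω * π0 ω a * (u ω a - u ω a') := Finset.sum_le_sum hW
      _ ≤ _ := Finset.sum_le_sum_of_subset_of_nonneg (Finset.subset_univ _)
          (fun ω _ _ => hterm0 ω)
  have hSs := hpers a a'
  have hpt : ∀ ω, (1 - δ) * (μ ω * πs ω a * (u ω a - u ω a'))
      + δ * (μ ω * π0 ω a * (u ω a - u ω a')) - |μ' ω - μ ω|
      ≤ μ' ω * ((1 - δ) * πs ω a + δ * π0 ω a) * (u ω a - u ω a') := by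
    intro ω
    have hq0 : 0 ≤ (1 - δ) * πs ω a + δ * π0 ω a :=
      add_nonneg (mul_nonneg (by linarith) (hπs.1 ω a)) (mul_nonneg hδ0 (hπ0.1 ω a))
    have hq1 : (1 - δ) * πs ω a + δ * π0 ω a ≤ 1 := by
      have h1 := mul_le_mul_of_nonneg_left (le1 πs hπs ω) (sub_nonneg.2 hδ)
      have h2 := mul_le_mul_of_nonneg_left (le1 π0 hπ0 ω) hδ0
      linarith
    have hΔ : |u ω a - u ω a'| ≤ 1 := by
      have h1 := hu ω a
      have h2 := hu ω a'
      rw [abs_le]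
      constructor <;> linarith [h1.1, h1.2, h2.1, h2.2]
    have hqΔ : |((1 - δ) * πs ω a + δ * π0 ω a) * (u ω a - u ω a')| ≤ 1 := by
      rw [abs_mul, abs_of_nonneg hq0]
      exact mul_le_one₀ hq1 (abs_nonneg _) hΔ
    have h3 : |(μ' ω - μ ω) * (((1 - δ) * πs ω a + δ * π0 ω a) * (u ω a - u ω a'))|
        ≤ |μ' ω - μ ω| := by
      rw [abs_mul]
      exact mul_le_of_le_one_right (abs_nonneg _) hqΔ
    have h4 := (abs_le.1 h3).1
    linarith
  have hsum := Finset.sum_le_sum (s := Finset.univ) (fun ω _ => hpt ω)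
  rw [Finset.sum_sub_distrib, Finset.sum_add_distrib, ← Finset.mul_sum, ← Finset.mul_sum] at hsum
  have h5 := mul_le_mul_of_nonneg_left hS0 hδ0
  have h6 := mul_nonneg (sub_nonneg.2 hδ) hSs
  unfold l1dist at hl
  linarith
end

section
/- Suppose the prior μ is (p₀,D)-regular with respect to u. Then for every ε > 0, every H > 0, every Q : Ω × A → [0,H], and every signaling scheme π* persuasive for μ, there exists a signaling scheme π that is persuasive for every prior μ̃ with ‖μ̃ − μ‖₁ ≤ ε and satisfies ⟨Q, μ⊗π⟩ ≥ ⟨Q, μ⊗π*⟩ − H·ε/(p₀·D). In other words, the robustness gap — the maximum of ⟨Q, μ⊗π⟩ over schemes π persuasive for μ, minus the maximum of ⟨Q, μ⊗π⟩ over schemes π simultaneously persuasive for all μ̃ with ‖μ̃ − μ‖₁ ≤ ε — is at most H·ε/(p₀·D). -/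
open Finset
open scoped Classical

/-- `⟨Q, μ⊗π⟩ = ∑_ω ∑_a μ(ω) π(a|ω) Q(ω,a)`. -/
def innerQ {Ω A : Type*} [Fintype Ω] [Fintype A]
    (Q : Ω → A → ℝ) (μ : Ω → ℝ) (π : Ω → A → ℝ) : ℝ :=
  ∑ ω, ∑ a, μ ω * π ω a * Q ω a

theorem stmt4 {Ω A : Type*} [Fintype Ω] [Nonempty Ω] [Fintype A]
    (hA : 2 ≤ Fintype.card A)
    (u : Ω → A → ℝ) (hu : ∀ ω a, u ω a ∈ Set.Icc (0 : ℝ) 1)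
    (p₀ D : ℝ) (hp₀ : p₀ ∈ Set.Ioc (0 : ℝ) 1) (hD : D ∈ Set.Ioc (0 : ℝ) 1)
    (μ : Ω → ℝ) (hμ : IsPrior μ) (hreg : Regular u μ p₀ D) :
    ∀ ε : ℝ, 0 < ε → ∀ H : ℝ, 0 < H →
      ∀ Q : Ω → A → ℝ, (∀ ω a, Q ω a ∈ Set.Icc (0 : ℝ) H) →
      ∀ πs : Ω → A → ℝ, IsScheme πs → Persuasive u μ πs →
      ∃ π : Ω → A → ℝ, IsScheme π ∧
        (∀ μ' : Ω → ℝ, IsPrior μ' → l1dist μ' μ ≤ ε → Persuasive u μ' π) ∧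
        innerQ Q μ πs - H * ε / (p₀ * D) ≤ innerQ Q μ π := by
  intro ε hε H hH Q hQ πs hπs hpers
  obtain ⟨hp0, hp1⟩ := hp₀
  obtain ⟨hD0, hD1⟩ := hD
  obtain ⟨hμ0, hμ1⟩ := hμ
  obtain ⟨hs0, hs1⟩ := hπs
  have : Nonempty A := Fintype.card_pos_iff.mp (by omega)
  have hbest : ∀ ω, ∃ a, ∀ a', u ω a' ≤ u ω a := fun ω => Finite.exists_max (u ω)
  choose b hb using hbest
  have hW : ∀ a ω, ω ∈ Wset u a D → b ω = a := by
    intro a ω hω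
    by_contra hne
    have h1 := (Finset.mem_filter.mp hω).2 (b ω) hne
    have h2 := hb ω a
    linarith
  let π0 : Ω → A → ℝ := fun ω a => if a = b ω then 1 else 0
  have h00 : ∀ ω a, 0 ≤ π0 ω a := by
    intro ω a; simp only [π0]; split_ifs <;> norm_num
  have h01 : ∀ ω, ∑ a, π0 ω a = 1 := by
    intro ω; simp [π0]
  have hterm : ∀ ω a a', 0 ≤ π0 ω a * (u ω a - u ω a') := by
    intro ω a a'
    simp only [π0]
    split_ifs with h
    · subst h; linarith [hb ω a']
    · simp
  -- bounds on the value of Q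
  have hQ0 : ∀ π : Ω → A → ℝ, IsScheme π → 0 ≤ innerQ Q μ π := by
    intro π hπ
    exact Finset.sum_nonneg fun ω _ => Finset.sum_nonneg fun a _ =>
      mul_nonneg (mul_nonneg (hμ0 ω) (hπ.1 ω a)) (hQ ω a).1
  have hQH : innerQ Q μ πs ≤ H := by
    calc innerQ Q μ πs ≤ ∑ ω, ∑ a, μ ω * πs ω a * H := by
          refine Finset.sum_le_sum fun ω _ => Finset.sum_le_sum fun a _ => ?_
          exact mul_le_mul_of_nonneg_left (hQ ω a).2 (mul_nonneg (hμ0 ω) (hs0 ω a))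
      _ = H := by
          simp only [← Finset.sum_mul, ← Finset.mul_sum, hs1, mul_one, hμ1, one_mul]
  have hpD : 0 < p₀ * D := mul_pos hp0 hD0
  have hS0 : IsScheme π0 := ⟨h00, h01⟩
  rw [mul_div_assoc]
  obtain ⟨δ, hδ⟩ : ∃ δ, δ = ε / (p₀ * D) := ⟨_, rfl⟩
  have hδ0 : 0 < δ := hδ ▸ div_pos hε hpD
  have hδm : δ * (p₀ * D) = ε := by rw [hδ]; field_simp
  rw [← hδ]
  by_cases hd : 1 ≤ δ
  · refine ⟨π0, hS0, ?_, ?_⟩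
    · intro μ' hμ' _ a a'
      refine Finset.sum_nonneg fun ω _ => ?_
      rw [mul_assoc]
      exact mul_nonneg (hμ'.1 ω) (hterm ω a a')
    · have := hQ0 π0 hS0
      nlinarith
  · push Not at hd
    have hS : IsScheme (fun ω a => (1 - δ) * πs ω a + δ * π0 ω a) := by
      refine ⟨fun ω a => ?_, fun ω => ?_⟩
      · exact add_nonneg (mul_nonneg (by linarith) (hs0 ω a)) (mul_nonneg hδ0.le (h00 ω a))
      · rw [Finset.sum_add_distrib, ← Finset.mul_sum, ← Finset.mul_sum, hs1, h01]; ring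
    refine ⟨_, hS, ?_, ?_⟩
    · intro μ' hμ' hdist a a'
      by_cases haa : a' = a
      · subst haa; simp
      have hle1 : ∀ ω, (1 - δ) * πs ω a + δ * π0 ω a ≤ 1 := by
        intro ω
        refine le_trans ?_ (hS.2 ω).le
        exact Finset.single_le_sum (f := fun a => (1 - δ) * πs ω a + δ * π0 ω a)
          (fun c _ => hS.1 ω c) (Finset.mem_univ a)
      have hslack : p₀ * D ≤ ∑ ω, μ ω * (π0 ω a * (u ω a - u ω a')) := by
        calc p₀ * D ≤ (∑ ω ∈ Wset u a D, μ ω) * D :=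
              mul_le_mul_of_nonneg_right (hreg a) hD0.le
          _ = ∑ ω ∈ Wset u a D, μ ω * D := Finset.sum_mul _ _ _
          _ ≤ ∑ ω ∈ Wset u a D, μ ω * (π0 ω a * (u ω a - u ω a')) := by
              refine Finset.sum_le_sum fun ω hω => ?_
              refine mul_le_mul_of_nonneg_left ?_ (hμ0 ω)
              have h1 := (Finset.mem_filter.mp hω).2 a' haa
              have h2 : π0 ω a = 1 := by simp [π0, hW a ω hω]
              rw [h2]; linarith
          _ ≤ _ := Finset.sum_le_sum_of_subset_of_nonneg (Finset.subset_univ _)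
              fun ω _ _ => mul_nonneg (hμ0 ω) (hterm ω a a')
      have hpert : -ε ≤ ∑ ω, (μ' ω - μ ω) *
          (((1 - δ) * πs ω a + δ * π0 ω a) * (u ω a - u ω a')) := by
        calc -ε ≤ -(∑ ω, |μ' ω - μ ω|) := neg_le_neg hdist
          _ = ∑ ω, -|μ' ω - μ ω| := by rw [Finset.sum_neg_distrib]
          _ ≤ _ := by
              refine Finset.sum_le_sum fun ω _ => ?_
              refine (abs_le.mp ?_).1
              rw [abs_mul]
              refine mul_le_of_le_one_right (abs_nonneg _) ?_
              rw [abs_mul, abs_of_nonneg (hS.1 ω a)]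
              refine mul_le_one₀ (hle1 ω) (abs_nonneg _) ?_
              rw [abs_le]
              have h1 := hu ω a
              have h2 := hu ω a'
              exact ⟨by linarith [h1.1, h2.2], by linarith [h1.2, h2.1]⟩
      have hp := hpers a a'
      have hsplit : ∑ ω, μ' ω * ((1 - δ) * πs ω a + δ * π0 ω a) * (u ω a - u ω a')
          = (1 - δ) * ∑ ω, μ ω * πs ω a * (u ω a - u ω a')
            + δ * ∑ ω, μ ω * (π0 ω a * (u ω a - u ω a'))
            + ∑ ω, (μ' ω - μ ω) *
              (((1 - δ) * πs ω a + δ * π0 ω a) * (u ω a - u ω a')) := by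
        rw [Finset.mul_sum, Finset.mul_sum, ← Finset.sum_add_distrib, ← Finset.sum_add_distrib]
        exact Finset.sum_congr rfl fun ω _ => by ring
      change 0 ≤ ∑ ω, μ' ω * ((1 - δ) * πs ω a + δ * π0 ω a) * (u ω a - u ω a')
      rw [hsplit]
      have e1 := mul_nonneg (sub_nonneg.mpr hd.le) hp
      have e2 := mul_le_mul_of_nonneg_left hslack hδ0.le
      linarith
    · have hsplit : innerQ Q μ (fun ω a => (1 - δ) * πs ω a + δ * π0 ω a)
          = (1 - δ) * innerQ Q μ πs + δ * innerQ Q μ π0 := by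
        unfold innerQ
        simp only [Finset.mul_sum, ← Finset.sum_add_distrib]
        exact Finset.sum_congr rfl fun ω _ => Finset.sum_congr rfl fun a _ => by ring
      rw [hsplit]
      have e1 := mul_nonneg hδ0.le (hQ0 π0 hS0)
      have e2 := mul_le_mul_of_nonneg_left hQH hδ0.le
      linarith
end

section
/- Suppose the prior μ* is (p₀,D)-regular with respect to u and μ̂ is a prior with ‖μ̂ − μ*‖₁ ≤ ε for some ε > 0. Then for every H > 0, every Q : Ω × A → [0,H], and every signaling scheme π̂ persuasive for μ̂, there exists a signaling scheme π that is persuasive for every prior μ̃ with ‖μ̃ − μ̂‖₁ ≤ ε and satisfies ⟨Q, μ̂⊗π⟩ ≥ ⟨Q, μ̂⊗π̂⟩ − 2H·ε/(p₀·D). -/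
open Finset
open scoped Classical

theorem stmt6 {Ω A : Type*} [Fintype Ω] [Nonempty Ω] [Fintype A]
    (hA : 2 ≤ Fintype.card A)
    (u : Ω → A → ℝ) (hu : ∀ ω a, u ω a ∈ Set.Icc (0 : ℝ) 1)
    (p₀ D : ℝ) (hp₀ : p₀ ∈ Set.Ioc (0 : ℝ) 1) (hD : D ∈ Set.Ioc (0 : ℝ) 1)
    (μs : Ω → ℝ) (hμs : IsPrior μs) (hreg : Regular u μs p₀ D)
    (μh : Ω → ℝ) (hμh : IsPrior μh)
    (ε : ℝ) (hε : 0 < ε) (hdist : l1dist μh μs ≤ ε) :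
    ∀ H : ℝ, 0 < H →
      ∀ Q : Ω → A → ℝ, (∀ ω a, Q ω a ∈ Set.Icc (0 : ℝ) H) →
      ∀ πh : Ω → A → ℝ, IsScheme πh → Persuasive u μh πh →
      ∃ π : Ω → A → ℝ, IsScheme π ∧
        (∀ μ' : Ω → ℝ, IsPrior μ' → l1dist μ' μh ≤ ε → Persuasive u μ' π) ∧
        innerQ Q μh πh - 2 * H * ε / (p₀ * D) ≤ innerQ Q μh π := by
  intro H hH Q hQ πh hπh hper
  obtain ⟨hp0, hp1⟩ := hp₀
  obtain ⟨hD0, hD1⟩ := hD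
  haveI : Nonempty A := Fintype.card_pos_iff.mp (by omega)
  have hb : ∀ ω, ∃ b, ∀ a, u ω a ≤ u ω b := fun ω => Finite.exists_max (u ω)
  choose b hb using hb
  set π0 : Ω → A → ℝ := fun ω a => if b ω = a then 1 else 0 with hπ0
  have hs0 : IsScheme π0 := by
    refine ⟨fun ω a => ?_, fun ω => ?_⟩
    · simp only [hπ0]; split_ifs <;> norm_num
    · simp [hπ0]
  have hterm : ∀ ω a a', 0 ≤ π0 ω a * (u ω a - u ω a') := by
    intro ω a a'
    simp only [hπ0]
    split_ifs with h
    · subst h; linarith [hb ω a']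
    · simp
  have hW : ∀ a, ∀ ω ∈ Wset u a D, b ω = a := by
    intro a ω hω
    simp only [Wset, Finset.mem_filter, Finset.mem_univ, true_and] at hω
    by_contra hne
    linarith [hω _ hne, hb ω a]
  have hq0 : 0 ≤ innerQ Q μh π0 :=
    Finset.sum_nonneg fun ω _ => Finset.sum_nonneg fun a _ =>
      mul_nonneg (mul_nonneg (hμh.1 ω) (hs0.1 ω a)) (hQ ω a).1
  have hqH : innerQ Q μh πh ≤ H := by
    calc innerQ Q μh πh ≤ ∑ ω, ∑ a, μh ω * πh ω a * H :=
          Finset.sum_le_sum fun ω _ => Finset.sum_le_sum fun a _ =>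
            mul_le_mul_of_nonneg_left (hQ ω a).2 (mul_nonneg (hμh.1 ω) (hπh.1 ω a))
      _ = H := by
          simp only [← Finset.sum_mul, ← Finset.mul_sum, hπh.2, hμh.2, mul_one, one_mul]
  have hpD : 0 < p₀ * D := mul_pos hp0 hD0
  set δ := 2 * ε / (p₀ * D) with hδ
  have hδ0 : 0 < δ := by positivity
  have hδe : δ * (p₀ * D) = 2 * ε := by rw [hδ]; field_simp
  have hgoal : 2 * H * ε / (p₀ * D) = H * δ := by rw [hδ]; ring
  rw [hgoal]
  rcases le_or_gt 1 δ with h1 | h1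
  · refine ⟨π0, hs0, fun μ' hμ' _ a a' => Finset.sum_nonneg fun ω _ => ?_, ?_⟩
    · rw [mul_assoc]; exact mul_nonneg (hμ'.1 ω) (hterm ω a a')
    · nlinarith
  refine ⟨fun ω a => (1 - δ) * πh ω a + δ * π0 ω a, ⟨fun ω a => ?_, fun ω => ?_⟩, ?_, ?_⟩
  · exact add_nonneg (mul_nonneg (by linarith) (hπh.1 ω a)) (mul_nonneg hδ0.le (hs0.1 ω a))
  · rw [Finset.sum_add_distrib, ← Finset.mul_sum, ← Finset.mul_sum, hπh.2, hs0.2]; ring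
  · intro μ' hμ' hd a a'
    by_cases haa : a' = a
    · subst haa; simp
    have hsplit : ∑ ω, μ' ω * ((1 - δ) * πh ω a + δ * π0 ω a) * (u ω a - u ω a')
        = (1 - δ) * (∑ ω, μh ω * πh ω a * (u ω a - u ω a')
            + ∑ ω, (μ' ω - μh ω) * (πh ω a * (u ω a - u ω a')))
          + δ * ∑ ω, μ' ω * (π0 ω a * (u ω a - u ω a')) := by
      rw [← Finset.sum_add_distrib, Finset.mul_sum, Finset.mul_sum, ← Finset.sum_add_distrib]
      exact Finset.sum_congr rfl fun ω _ => by ring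
    have hB : -ε ≤ ∑ ω, (μ' ω - μh ω) * (πh ω a * (u ω a - u ω a')) := by
      have : ∑ ω, -|μ' ω - μh ω| ≤ ∑ ω, (μ' ω - μh ω) * (πh ω a * (u ω a - u ω a')) := by
        refine Finset.sum_le_sum fun ω _ => ?_
        have hle : πh ω a ≤ 1 := by
          rw [← hπh.2 ω]
          exact Finset.single_le_sum (fun i _ => hπh.1 ω i) (Finset.mem_univ a)
        have h2 : |πh ω a * (u ω a - u ω a')| ≤ 1 := by
          rw [abs_mul]
          refine mul_le_one₀ (abs_le.2 ⟨by linarith [hπh.1 ω a], hle⟩) (abs_nonneg _) ?_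
          have := hu ω a
          have := hu ω a'
          simp only [Set.mem_Icc] at *
          exact abs_le.2 ⟨by linarith, by linarith⟩
        have h3 := neg_abs_le ((μ' ω - μh ω) * (πh ω a * (u ω a - u ω a')))
        rw [abs_mul] at h3
        have h4 := mul_le_mul_of_nonneg_left h2 (abs_nonneg (μ' ω - μh ω))
        linarith
      rw [Finset.sum_neg_distrib] at this
      unfold l1dist at hd
      linarith
    have hC : D * (p₀ - 2 * ε) ≤ ∑ ω, μ' ω * (π0 ω a * (u ω a - u ω a')) := by
      have h1 : ∑ ω ∈ Wset u a D, μ' ω * D ≤ ∑ ω, μ' ω * (π0 ω a * (u ω a - u ω a')) := by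
        refine le_trans (Finset.sum_le_sum fun ω hω => ?_)
          (Finset.sum_le_sum_of_subset_of_nonneg (Finset.subset_univ (Wset u a D))
            fun ω _ _ => mul_nonneg (hμ'.1 ω) (hterm ω a a'))
        have hbω := hW a ω hω
        refine mul_le_mul_of_nonneg_left ?_ (hμ'.1 ω)
        simp only [Wset, Finset.mem_filter, Finset.mem_univ, true_and] at hω
        simp only [hπ0, hbω, if_true]
        linarith [hω a' haa]
      have h2 : ∑ ω ∈ Wset u a D, (μs ω - μ' ω) ≤ 2 * ε := by
        calc ∑ ω ∈ Wset u a D, (μs ω - μ' ω)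
            ≤ ∑ ω ∈ Wset u a D, (|μh ω - μs ω| + |μ' ω - μh ω|) :=
              Finset.sum_le_sum fun ω _ => by
                linarith [neg_abs_le (μh ω - μs ω), neg_abs_le (μ' ω - μh ω)]
          _ ≤ ∑ ω, (|μh ω - μs ω| + |μ' ω - μh ω|) :=
              Finset.sum_le_sum_of_subset_of_nonneg (Finset.subset_univ _)
                fun ω _ _ => by positivity
          _ ≤ 2 * ε := by
              rw [Finset.sum_add_distrib]
              unfold l1dist at hd hdist
              linarith
      rw [Finset.sum_sub_distrib] at h2
      rw [← Finset.sum_mul] at h1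
      have h3 := hreg a
      have h4 : p₀ - 2 * ε ≤ ∑ ω ∈ Wset u a D, μ' ω := by linarith
      nlinarith
    have hA' := hper a a'
    rw [hsplit]
    have e1 : (1 - δ) * (-ε) ≤ (1 - δ) * (∑ ω, μh ω * πh ω a * (u ω a - u ω a')
            + ∑ ω, (μ' ω - μh ω) * (πh ω a * (u ω a - u ω a'))) :=
      mul_le_mul_of_nonneg_left (by linarith) (by linarith)
    have e2 := mul_le_mul_of_nonneg_left hC hδ0.le
    have e3 : 0 ≤ (1 - δ) * (-ε) + δ * (D * (p₀ - 2 * ε)) := by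
      have : (1 - δ) * (-ε) + δ * (D * (p₀ - 2 * ε)) = ε * (1 + δ - 2 * (δ * D)) := by
        linear_combination hδe
      rw [this]
      refine mul_nonneg hε.le ?_
      nlinarith
    linarith
  · have : innerQ Q μh (fun ω a => (1 - δ) * πh ω a + δ * π0 ω a)
        = (1 - δ) * innerQ Q μh πh + δ * innerQ Q μh π0 := by
      simp only [innerQ, Finset.mul_sum, ← Finset.sum_add_distrib]
      exact Finset.sum_congr rfl fun ω _ => Finset.sum_congr rfl fun a _ => by ring
    rw [this]
    nlinarith
end

section
/- Let μ₁, μ₂ be priors, H > 0, and Q : Ω × A → [0,H]. Let Pers(μᵢ) denote the set of signaling schemes persuasive for μᵢ, and let Pers(B₁₂) denote the set of signaling schemes simultaneously persuasive for every prior μ̃ with ‖μ̃ − μ₁‖₁ ≤ ‖μ₁ − μ₂‖₁. Then max_{π ∈ Pers(μ₁)} ⟨Q, μ₁⊗π⟩ − max_{π ∈ Pers(μ₂)} ⟨Q, μ₂⊗π⟩ ≤ (max_{π ∈ Pers(μ₁)} ⟨Q, μ₁⊗π⟩ − max_{π ∈ Pers(B₁₂)} ⟨Q, μ₁⊗π⟩)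 + (H/2)·‖μ₁ − μ₂‖₁. (All three maxima are attained, since each persuasive set is a nonempty compact subset of a finite-dimensional space and the objective is continuous.) -/
open Finset

/-- Values `⟨Q, μval⊗π⟩` achieved by signaling schemes `π` satisfying the predicate `P`. -/
def persVals {Ω A : Type*} [Fintype Ω] [Fintype A]
    (Q : Ω → A → ℝ) (μval : Ω → ℝ) (P : (Ω → A → ℝ) → Prop) : Set ℝ :=
  {x | ∃ π : Ω → A → ℝ, IsScheme π ∧ P π ∧ x = innerQ Q μval π}

theorem reveal_exists {Ω A : Type*} [Fintype Ω] [Fintype A] [Nonempty A]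
    (u : Ω → A → ℝ) : ∃ π : Ω → A → ℝ, IsScheme π ∧
      ∀ μ, IsPrior μ → Persuasive u μ π := by
  classical
  have h : ∀ ω, ∃ a, ∀ a', u ω a' ≤ u ω a := fun ω => Finite.exists_max (u ω)
  choose f hf using h
  refine ⟨fun ω a => if a = f ω then 1 else 0, ⟨fun ω a => ?_, fun ω => ?_⟩, ?_⟩
  · dsimp only
    split_ifs <;> norm_num
  · simp
  · intro μ hμ a a'
    refine Finset.sum_nonneg fun ω _ => ?_
    dsimp only
    split_ifs with h
    · subst h
      have := hf ω a'
      have h2 := hμ.1 ω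
      rw [mul_one]
      exact mul_nonneg h2 (by linarith)
    · simp

theorem isCompact_scheme (Ω A : Type*) [Fintype Ω] [Fintype A] :
    IsCompact {π : Ω → A → ℝ | IsScheme π} := by
  have h : IsCompact (Set.univ.pi fun _ : Ω => stdSimplex ℝ A) :=
    isCompact_univ_pi fun _ => isCompact_stdSimplex ℝ A
  convert h using 1
  ext π
  simp only [Set.mem_setOf_eq, IsScheme, Set.mem_pi, Set.mem_univ, stdSimplex, true_implies]
  exact ⟨fun h ω => ⟨h.1 ω, h.2 ω⟩, fun h => ⟨fun ω => (h ω).1, fun ω => (h ω).2⟩⟩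

theorem isClosed_pers {Ω A : Type*} [Fintype Ω] [Fintype A] (u : Ω → A → ℝ) (μ : Ω → ℝ) :
    IsClosed {π : Ω → A → ℝ | Persuasive u μ π} := by
  simp only [Persuasive, Set.setOf_forall]
  refine isClosed_iInter fun a => isClosed_iInter fun a' => ?_
  exact isClosed_le (by fun_prop) (by fun_prop)

theorem greatest_exists {Ω A : Type*} [Fintype Ω] [Fintype A]
    (Q : Ω → A → ℝ) (ν : Ω → ℝ) (P : (Ω → A → ℝ) → Prop)
    (hc : IsClosed {π | P π}) (hn : ∃ π, IsScheme π ∧ P π) :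
    ∃ x, IsGreatest (persVals Q ν P) x := by
  obtain ⟨π₀, h0, h0'⟩ := hn
  have hK := (isCompact_scheme Ω A).inter_right hc
  have hcont : Continuous (fun π : Ω → A → ℝ => innerQ Q ν π) := by
    unfold innerQ
    fun_prop
  obtain ⟨π, hπ, hmax⟩ := hK.exists_isMaxOn ⟨π₀, h0, h0'⟩ hcont.continuousOn
  refine ⟨innerQ Q ν π, ⟨π, hπ.1, hπ.2, rfl⟩, ?_⟩
  rintro x ⟨π', h1, h2, rfl⟩
  exact hmax ⟨h1, h2⟩

theorem innerQ_diff {Ω A : Type*} [Fintype Ω] [Fintype A]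
    (μ₁ μ₂ : Ω → ℝ) (hμ₁ : IsPrior μ₁) (hμ₂ : IsPrior μ₂) (H : ℝ)
    (Q : Ω → A → ℝ) (hQ : ∀ ω a, Q ω a ∈ Set.Icc (0 : ℝ) H)
    (π : Ω → A → ℝ) (hπ : IsScheme π) :
    innerQ Q μ₁ π - innerQ Q μ₂ π ≤ H / 2 * l1dist μ₁ μ₂ := by
  have key : ∀ μ, innerQ Q μ π = ∑ ω, μ ω * ∑ a, π ω a * Q ω a := by
    intro μ
    simp only [innerQ, Finset.mul_sum, mul_assoc]
  have e : innerQ Q μ₁ π - innerQ Q μ₂ π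
      = ∑ ω, (μ₁ ω - μ₂ ω) * ((∑ a, π ω a * Q ω a) - H / 2) := by
    have h : ∑ ω, (μ₁ ω - μ₂ ω) * (H / 2) = 0 := by
      rw [← Finset.sum_mul, Finset.sum_sub_distrib, hμ₁.2, hμ₂.2]; ring
    simp only [mul_sub]
    rw [Finset.sum_sub_distrib, h, key, key, ← Finset.sum_sub_distrib, sub_zero]
    exact Finset.sum_congr rfl fun ω _ => by ring
  rw [e, l1dist, Finset.mul_sum]
  refine Finset.sum_le_sum fun ω _ => ?_
  have h0 : 0 ≤ ∑ a, π ω a * Q ω a :=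
    Finset.sum_nonneg fun a _ => mul_nonneg (hπ.1 ω a) (hQ ω a).1
  have h1 : ∑ a, π ω a * Q ω a ≤ H := by
    calc _ ≤ ∑ a, π ω a * H :=
          Finset.sum_le_sum fun a _ => mul_le_mul_of_nonneg_left (hQ ω a).2 (hπ.1 ω a)
      _ = H := by rw [← Finset.sum_mul, hπ.2, one_mul]
  have h2 : |(∑ a, π ω a * Q ω a) - H / 2| ≤ H / 2 := abs_le.2 ⟨by linarith, by linarith⟩
  calc _ ≤ |(μ₁ ω - μ₂ ω) * ((∑ a, π ω a * Q ω a) - H / 2)| := le_abs_self _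
    _ = |(∑ a, π ω a * Q ω a) - H / 2| * |μ₁ ω - μ₂ ω| := by rw [abs_mul, mul_comm]
    _ ≤ _ := mul_le_mul_of_nonneg_right h2 (abs_nonneg _)

theorem stmt7 {Ω A : Type*} [Fintype Ω] [Nonempty Ω] [Fintype A]
    (hA : 2 ≤ Fintype.card A)
    (u : Ω → A → ℝ) (hu : ∀ ω a, u ω a ∈ Set.Icc (0 : ℝ) 1)
    (μ₁ μ₂ : Ω → ℝ) (hμ₁ : IsPrior μ₁) (hμ₂ : IsPrior μ₂)
    (H : ℝ) (hH : 0 < H)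
    (Q : Ω → A → ℝ) (hQ : ∀ ω a, Q ω a ∈ Set.Icc (0 : ℝ) H) :
    (∃ x, IsGreatest (persVals Q μ₁ (Persuasive u μ₁)) x) ∧
    (∃ x, IsGreatest (persVals Q μ₂ (Persuasive u μ₂)) x) ∧
    (∃ x, IsGreatest (persVals Q μ₁
      (fun π => ∀ μ' : Ω → ℝ, IsPrior μ' → l1dist μ' μ₁ ≤ l1dist μ₁ μ₂ →
        Persuasive u μ' π)) x) ∧
    sSup (persVals Q μ₁ (Persuasive u μ₁)) -
        sSup (persVals Q μ₂ (Persuasive u μ₂)) ≤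
      (sSup (persVals Q μ₁ (Persuasive u μ₁)) -
          sSup (persVals Q μ₁
            (fun π => ∀ μ' : Ω → ℝ, IsPrior μ' → l1dist μ' μ₁ ≤ l1dist μ₁ μ₂ →
              Persuasive u μ' π))) +
        H / 2 * l1dist μ₁ μ₂ := by
  haveI : Nonempty A := Fintype.card_pos_iff.1 (by omega)
  obtain ⟨π₀, h0, hp⟩ := reveal_exists u
  have g1 := greatest_exists Q μ₁ (Persuasive u μ₁) (isClosed_pers u μ₁) ⟨π₀, h0, hp _ hμ₁⟩
  have g2 := greatest_exists Q μ₂ (Persuasive u μ₂) (isClosed_pers u μ₂) ⟨π₀, h0, hp _ hμ₂⟩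
  have g3 := greatest_exists Q μ₁
    (fun π => ∀ μ' : Ω → ℝ, IsPrior μ' → l1dist μ' μ₁ ≤ l1dist μ₁ μ₂ → Persuasive u μ' π)
    (by
      simp only [Set.setOf_forall]
      exact isClosed_iInter fun μ' => isClosed_iInter fun _ => isClosed_iInter fun _ =>
        isClosed_pers u μ')
    ⟨π₀, h0, fun μ' h _ => hp μ' h⟩
  refine ⟨g1, g2, g3, ?_⟩
  obtain ⟨y, hy⟩ := g2
  obtain ⟨z, hz⟩ := g3
  rw [hy.csSup_eq, hz.csSup_eq]
  obtain ⟨π, hs, hP, rfl⟩ := hz.1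
  have hl : l1dist μ₂ μ₁ ≤ l1dist μ₁ μ₂ := by
    unfold l1dist
    exact le_of_eq (Finset.sum_congr rfl fun ω _ => abs_sub_comm _ _)
  have h1 : innerQ Q μ₂ π ≤ y := hy.2 ⟨π, hs, hP μ₂ hμ₂ hl, rfl⟩
  have h2 := innerQ_diff μ₁ μ₂ hμ₁ hμ₂ H Q hQ π hs
  linarith
end

section
/- Suppose the family of priors (μ_θ)_{θ∈ℝ^d} satisfies ‖μ_{θ₁} − μ_{θ₂}‖₁ ≤ L_μ·|f(φᵀθ₁) − f(φᵀθ₂)| for all θ₁, θ₂ ∈ ℝ^d, where f : ℝ → ℝ is differentiable with |f'(z)| ≤ K for all z ∈ ℝ. Fix θ ∈ ℝ^d and suppose μ_θ is (p₀,D)-regular with respect to u. Then for every ε > 0, every H > 0, every Q : Ω × A → [0,H], and every signaling scheme π* persuasive for μ_θ, there exists a signaling scheme π that is persuasive for every prior μ_{θ'} with ‖θ' − θ‖_Σ ≤ ε and satisfies ⟨Q, μ_θ⊗π⟩ ≥ ⟨Q, μ_θ⊗π*⟩ − H·L_μ·K·‖φ‖_{Σ⁻¹}·ε/(p₀·D).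 -/
open Finset Matrix
open scoped Classical

/-- The `Σ`-weighted norm `‖v‖_Σ = √(vᵀ Σ v)` of a vector. -/
noncomputable def matNorm {d : ℕ} (S : Matrix (Fin d) (Fin d) ℝ) (v : Fin d → ℝ) : ℝ :=
  Real.sqrt (v ⬝ᵥ S.mulVec v)


lemma aux_cs {d : ℕ} (S : Matrix (Fin d) (Fin d) ℝ) (hS : S.PosDef) (φ v : Fin d → ℝ) :
    |φ ⬝ᵥ v| ≤ matNorm S⁻¹ φ * matNorm S v := by
  have hdet : IsUnit S.det := (Matrix.isUnit_iff_isUnit_det S).1 hS.isUnit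
  have hsymm : Sᵀ = S := by
    have := hS.isHermitian.eq
    simpa [Matrix.conjTranspose_eq_transpose_of_trivial] using this
  set w := S⁻¹.mulVec φ with hw
  have hSw : S.mulVec w = φ := by
    rw [hw, Matrix.mulVec_mulVec, Matrix.mul_nonsing_inv _ hdet, Matrix.one_mulVec]
  have hnn : ∀ x : Fin d → ℝ, 0 ≤ x ⬝ᵥ S.mulVec x := fun x => by
    simpa using hS.posSemidef.dotProduct_mulVec_nonneg x
  have h1 : w ⬝ᵥ S.mulVec v = φ ⬝ᵥ v := by
    rw [Matrix.dotProduct_mulVec, ← Matrix.mulVec_transpose, hsymm, hSw]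
  have h2 : v ⬝ᵥ S.mulVec w = φ ⬝ᵥ v := by rw [hSw, dotProduct_comm]
  have h3 : w ⬝ᵥ S.mulVec w = φ ⬝ᵥ S⁻¹.mulVec φ := by rw [hSw, dotProduct_comm]
  have hq : ∀ t : ℝ, 0 ≤ (φ ⬝ᵥ S⁻¹.mulVec φ) * (t * t) + (2 * (φ ⬝ᵥ v)) * t + v ⬝ᵥ S.mulVec v := by
    intro t
    have := hnn (v + t • w)
    simp only [Matrix.mulVec_add, Matrix.mulVec_smul, add_dotProduct, dotProduct_add,
      smul_dotProduct, dotProduct_smul, smul_eq_mul, h1, h2, h3] at this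
    linarith
  have hd := discrim_le_zero hq
  rw [discrim] at hd
  unfold matNorm
  have h4 : 0 ≤ φ ⬝ᵥ S⁻¹.mulVec φ := h3 ▸ hnn w
  rw [← Real.sqrt_mul h4]
  apply Real.abs_le_sqrt
  nlinarith

lemma aux_mv (f : ℝ → ℝ) (hf : Differentiable ℝ f) (K : ℝ) (hf' : ∀ z : ℝ, |deriv f z| ≤ K)
    (x y : ℝ) : |f x - f y| ≤ K * |x - y| := by
  have := Convex.norm_image_sub_le_of_norm_deriv_le (𝕜 := ℝ) (f := f) (s := Set.univ) (C := K)
    (x := y) (y := x) (fun z _ => hf z) (fun z _ => by simpa using hf' z) convex_univ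
    (Set.mem_univ _) (Set.mem_univ _)
  simpa using this

section
variable {Ω A : Type*} [Fintype Ω] [Fintype A]

lemma aux_full [Nonempty A] (u : Ω → A → ℝ) (D : ℝ) (hD : 0 < D) :
    ∃ g : Ω → A → ℝ, IsScheme g ∧ (∀ ω a a', 0 ≤ g ω a * (u ω a - u ω a')) ∧
      ∀ a, ∀ ω ∈ Wset u a D, g ω a = 1 := by
  choose b hb using fun ω => Finite.exists_max (u ω)
  refine ⟨fun ω a => if a = b ω then 1 else 0, ⟨fun ω a => ?_, fun ω => by simp⟩,
    fun ω a a' => ?_, fun a ω h => ?_⟩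
  · dsimp only; split_ifs <;> norm_num
  · dsimp only; split_ifs with h
    · subst h; linarith [hb ω a']
    · simp
  · simp only [Wset, mem_filter, mem_univ, true_and] at h
    refine if_pos ?_
    by_contra hne
    have := h (b ω) (Ne.symm hne)
    linarith [hb ω a]

lemma aux_scheme_le {g : Ω → A → ℝ} (hg : IsScheme g) (ω : Ω) (a : A) : g ω a ≤ 1 := by
  rw [← hg.2 ω]
  exact Finset.single_le_sum (f := g ω) (fun i _ => hg.1 ω i) (mem_univ a)

lemma aux_innerQ {Q : Ω → A → ℝ} {H : ℝ} (hQ : ∀ ω a, Q ω a ∈ Set.Icc (0 : ℝ) H)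
    {μ : Ω → ℝ} (hμ : IsPrior μ) {g : Ω → A → ℝ} (hg : IsScheme g) :
    0 ≤ innerQ Q μ g ∧ innerQ Q μ g ≤ H := by
  constructor
  · exact Finset.sum_nonneg fun ω _ => Finset.sum_nonneg fun a _ =>
      mul_nonneg (mul_nonneg (hμ.1 ω) (hg.1 ω a)) (hQ ω a).1
  · calc innerQ Q μ g ≤ ∑ ω, ∑ a, μ ω * g ω a * H :=
          Finset.sum_le_sum fun ω _ => Finset.sum_le_sum fun a _ =>
            mul_le_mul_of_nonneg_left (hQ ω a).2 (mul_nonneg (hμ.1 ω) (hg.1 ω a))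
      _ = H := by
          simp only [← Finset.sum_mul, ← Finset.mul_sum, hg.2, mul_one, hμ.2, one_mul]

lemma aux_diff {μ ν c : Ω → ℝ} (hc : ∀ ω, |c ω| ≤ 1) (s : Finset Ω) :
    ∑ ω ∈ s, μ ω * c ω - l1dist μ ν ≤ ∑ ω ∈ s, ν ω * c ω := by
  have : ∑ ω ∈ s, (μ ω * c ω - ν ω * c ω) ≤ ∑ ω, |μ ω - ν ω| := by
    calc _ ≤ ∑ ω ∈ s, |μ ω - ν ω| := Finset.sum_le_sum fun ω _ => by
            rw [← sub_mul]
            refine (le_abs_self _).trans ?_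
            rw [abs_mul]
            exact mul_le_of_le_one_right (abs_nonneg _) (hc ω)
      _ ≤ _ := Finset.sum_le_sum_of_subset_of_nonneg (subset_univ s) fun _ _ _ => abs_nonneg _
  rw [Finset.sum_sub_distrib] at this
  unfold l1dist
  linarith

lemma aux_main [Nonempty A] (u : Ω → A → ℝ) (hu : ∀ ω a, u ω a ∈ Set.Icc (0 : ℝ) 1)
    (p₀ D : ℝ) (hp₀ : p₀ ∈ Set.Ioc (0 : ℝ) 1) (hD : D ∈ Set.Ioc (0 : ℝ) 1)
    (μ : Ω → ℝ) (hμ : IsPrior μ) (hreg : Regular u μ p₀ D) (r : ℝ) (hr : 0 ≤ r)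
    (H : ℝ) (hH : 0 < H) (Q : Ω → A → ℝ) (hQ : ∀ ω a, Q ω a ∈ Set.Icc (0 : ℝ) H)
    (πs : Ω → A → ℝ) (hs : IsScheme πs) (hp : Persuasive u μ πs) :
    ∃ π : Ω → A → ℝ, IsScheme π ∧
      (∀ ν : Ω → ℝ, IsPrior ν → l1dist μ ν ≤ r → Persuasive u ν π) ∧
      innerQ Q μ πs - H * (r / (p₀ * D)) ≤ innerQ Q μ π := by
  obtain ⟨hp0, hp1⟩ := hp₀
  obtain ⟨hD0, hD1⟩ := hD
  obtain ⟨g, hg, hg1, hg2⟩ := aux_full u D hD0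
  have hpD : 0 < p₀ * D := mul_pos hp0 hD0
  have hgp : ∀ ν : Ω → ℝ, IsPrior ν → Persuasive u ν g := fun ν hν a a' =>
    Finset.sum_nonneg fun ω _ => by
      rw [mul_assoc]; exact mul_nonneg (hν.1 ω) (hg1 ω a a')
  by_cases hc : 1 ≤ r / (p₀ * D)
  · refine ⟨g, hg, fun ν hν _ => hgp ν hν, ?_⟩
    have := (aux_innerQ hQ hμ hs).2
    have := (aux_innerQ hQ hμ hg).1
    nlinarith
  push Not at hc
  set δ := r / (p₀ * D) with hδ
  have hδ0 : 0 ≤ δ := div_nonneg hr hpD.le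
  have hδr : δ * (p₀ * D) = r := div_mul_cancel₀ _ hpD.ne'
  refine ⟨fun ω a => (1 - δ) * πs ω a + δ * g ω a, ⟨fun ω a => ?_, fun ω => ?_⟩, ?_, ?_⟩
  · exact add_nonneg (mul_nonneg (by linarith) (hs.1 ω a)) (mul_nonneg hδ0 (hg.1 ω a))
  · rw [Finset.sum_add_distrib, ← Finset.mul_sum, ← Finset.mul_sum, hs.2, hg.2]; ring
  · intro ν hν hd a a'
    by_cases haa : a' = a
    · subst haa; simp
    have e : ∑ ω, ν ω * ((1 - δ) * πs ω a + δ * g ω a) * (u ω a - u ω a')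
        = (1 - δ) * ∑ ω, ν ω * (πs ω a * (u ω a - u ω a'))
          + δ * ∑ ω, ν ω * (g ω a * (u ω a - u ω a')) := by
      rw [Finset.mul_sum, Finset.mul_sum, ← Finset.sum_add_distrib]
      exact Finset.sum_congr rfl fun ω _ => by ring
    rw [e]
    have h1 := aux_diff (μ := μ) (ν := ν) (c := fun ω => πs ω a * (u ω a - u ω a'))
      (fun ω => by
        rw [abs_mul, abs_of_nonneg (hs.1 ω a)]
        refine mul_le_one₀ (aux_scheme_le hs ω a) (abs_nonneg _) ?_
        rw [abs_le]
        constructor <;> linarith [(hu ω a).1, (hu ω a).2, (hu ω a').1, (hu ω a').2]) univ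
    have h2 : 0 ≤ ∑ ω, μ ω * (πs ω a * (u ω a - u ω a')) := by
      have := hp a a'
      simpa only [mul_assoc] using this
    have h3 := aux_diff (μ := μ) (ν := ν) (c := fun _ => 1) (by simp) (Wset u a D)
    simp only [mul_one] at h3
    have h4 := hreg a
    have h5 : (∑ ω ∈ Wset u a D, ν ω) * D ≤ ∑ ω, ν ω * (g ω a * (u ω a - u ω a')) := by
      rw [Finset.sum_mul]
      calc _ ≤ ∑ ω ∈ Wset u a D, ν ω * (g ω a * (u ω a - u ω a')) :=
            Finset.sum_le_sum fun ω hω => by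
              rw [hg2 a ω hω, one_mul]
              simp only [Wset, mem_filter, mem_univ, true_and] at hω
              exact mul_le_mul_of_nonneg_left (by linarith [hω a' haa]) (hν.1 ω)
        _ ≤ _ := Finset.sum_le_sum_of_subset_of_nonneg (subset_univ _) fun ω _ _ =>
            mul_nonneg (hν.1 ω) (hg1 ω a a')
    have h6 : (p₀ - r) * D ≤ ∑ ω, ν ω * (g ω a * (u ω a - u ω a')) :=
      (mul_le_mul_of_nonneg_right (by linarith) hD0.le).trans h5
    have h7 : -r ≤ ∑ ω, ν ω * (πs ω a * (u ω a - u ω a')) := by linarith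
    have h8 := mul_le_mul_of_nonneg_left h7 (by linarith : 0 ≤ 1 - δ)
    have h9 := mul_le_mul_of_nonneg_left h6 hδ0
    have h10 : 0 ≤ δ * r * (1 - D) := mul_nonneg (mul_nonneg hδ0 hr) (by linarith)
    nlinarith
  · have e : innerQ Q μ (fun ω a => (1 - δ) * πs ω a + δ * g ω a)
        = (1 - δ) * innerQ Q μ πs + δ * innerQ Q μ g := by
      unfold innerQ
      simp only [Finset.mul_sum, ← Finset.sum_add_distrib]
      exact Finset.sum_congr rfl fun ω _ => Finset.sum_congr rfl fun a _ => by ring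
    rw [e]
    have h1 := mul_le_mul_of_nonneg_left (aux_innerQ hQ hμ hs).2 hδ0
    have h2 := mul_nonneg hδ0 (aux_innerQ hQ hμ hg).1
    linarith
end

theorem stmt9 {Ω A : Type*} [Fintype Ω] [Nonempty Ω] [Fintype A]
    (hA : 2 ≤ Fintype.card A)
    (u : Ω → A → ℝ) (hu : ∀ ω a, u ω a ∈ Set.Icc (0 : ℝ) 1)
    (p₀ D : ℝ) (hp₀ : p₀ ∈ Set.Ioc (0 : ℝ) 1) (hD : D ∈ Set.Ioc (0 : ℝ) 1)
    (d : ℕ) (hd : 1 ≤ d)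
    (φ : Fin d → ℝ) (S : Matrix (Fin d) (Fin d) ℝ) (hS : S.PosDef)
    (Lμ K : ℝ) (hLμ : 0 ≤ Lμ) (hK : 0 < K)
    (f : ℝ → ℝ) (hf : Differentiable ℝ f) (hf' : ∀ z : ℝ, |deriv f z| ≤ K)
    (μfam : (Fin d → ℝ) → Ω → ℝ) (hfam : ∀ θ', IsPrior (μfam θ'))
    (hLip : ∀ θ₁ θ₂ : Fin d → ℝ,
      l1dist (μfam θ₁) (μfam θ₂) ≤ Lμ * |f (φ ⬝ᵥ θ₁) - f (φ ⬝ᵥ θ₂)|)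
    (θ : Fin d → ℝ) (hreg : Regular u (μfam θ) p₀ D) :
    ∀ ε : ℝ, 0 < ε → ∀ H : ℝ, 0 < H →
      ∀ Q : Ω → A → ℝ, (∀ ω a, Q ω a ∈ Set.Icc (0 : ℝ) H) →
      ∀ πs : Ω → A → ℝ, IsScheme πs → Persuasive u (μfam θ) πs →
      ∃ π : Ω → A → ℝ, IsScheme π ∧
        (∀ θ' : Fin d → ℝ, matNorm S (θ' - θ) ≤ ε → Persuasive u (μfam θ') π) ∧
        innerQ Q (μfam θ) πs - H * Lμ * K * matNorm S⁻¹ φ * ε / (p₀ * D) ≤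
          innerQ Q (μfam θ) π := by
  intro ε hε H hH Q hQ πs hs hp
  haveI : Nonempty A := Fintype.card_pos_iff.1 (by omega)
  have hn : 0 ≤ matNorm S⁻¹ φ := Real.sqrt_nonneg _
  obtain ⟨π, h1, h2, h3⟩ := aux_main u hu p₀ D hp₀ hD (μfam θ) (hfam θ) hreg
    (Lμ * (K * (matNorm S⁻¹ φ * ε))) (by positivity) H hH Q hQ πs hs hp
  refine ⟨π, h1, fun θ' hθ' => h2 _ (hfam θ') ?_, ?_⟩
  · refine (hLip θ θ').trans (mul_le_mul_of_nonneg_left ?_ hLμ)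
    refine (aux_mv f hf K hf' _ _).trans (mul_le_mul_of_nonneg_left ?_ hK.le)
    rw [abs_sub_comm, ← dotProduct_sub]
    exact (aux_cs S hS φ _).trans (mul_le_mul_of_nonneg_left hθ' hn)
  · refine le_trans (le_of_eq ?_) h3
    ring
end

section
/- Let d ≥ 1, T ≥ 1, and let φ₁, …, φ_T ∈ ℝ^d satisfy ‖φ_t‖₂ ≤ Φ for all t, where Φ > 0. Let λ > 0 with λ ≥ Φ², and for each t ∈ {1, …, T} define the matrix Σ_t := λ·I_d + Σ_{i=1}^{t−1} φ_i φ_iᵀ. Then Σ_{t=1}^T √(φ_tᵀ Σ_t⁻¹ φ_t) ≤ √(2·d·T·log(1 + T·Φ²/(λ·d))). -/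
open Finset Matrix

lemma aux_quad (d : ℕ) (φ : ℕ → Fin d → ℝ) (lam : ℝ) (t : ℕ) (x : Fin d → ℝ) :
    x ⬝ᵥ (lam • (1 : Matrix (Fin d) (Fin d) ℝ) +
            ∑ i ∈ Finset.range t, vecMulVec (φ i) (φ i)).mulVec x
      = lam * (x ⬝ᵥ x) + ∑ i ∈ Finset.range t, (φ i ⬝ᵥ x) ^ 2 := by
  rw [add_mulVec, dotProduct_add, smul_mulVec, one_mulVec, dotProduct_smul, smul_eq_mul,
    Matrix.sum_mulVec, dotProduct_sum]
  congr 1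
  refine Finset.sum_congr rfl fun i _ => ?_
  rw [vecMulVec_mulVec, dotProduct_smul, dotProduct_comm x]
  simp [sq]

lemma aux_posDef (d : ℕ) (φ : ℕ → Fin d → ℝ) (lam : ℝ) (hlam : 0 < lam) (t : ℕ) :
    (lam • (1 : Matrix (Fin d) (Fin d) ℝ) +
            ∑ i ∈ Finset.range t, vecMulVec (φ i) (φ i)).PosDef := by
  refine (Matrix.PosDef.one.smul hlam).add_posSemidef ?_
  refine Matrix.posSemidef_sum _ fun i _ => ?_
  simpa using Matrix.posSemidef_vecMulVec_self_star (φ i)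

lemma aux_det (d : ℕ) (A : Matrix (Fin d) (Fin d) ℝ) (hA : IsUnit A.det) (u : Fin d → ℝ) :
    (A + vecMulVec u u).det = A.det * (1 + u ⬝ᵥ A⁻¹.mulVec u) := by
  have h := Matrix.det_add_replicateCol_mul_replicateRow (ι := Unit) hA u u
  rw [← vecMulVec_eq] at h
  rw [h]
  congr 1
  rw [Matrix.det_unique]
  rw [Matrix.mul_assoc, ← Matrix.replicateCol_mulVec, Matrix.add_apply, Matrix.one_apply_eq]
  simp [Matrix.mul_apply, dotProduct]

lemma aux_logdet (d : ℕ) (hd : 1 ≤ d) (A : Matrix (Fin d) (Fin d) ℝ) (hA : A.PosDef) (m : ℝ)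
    (hm : 0 < m) (h : A.trace ≤ d * m) : Real.log A.det ≤ d * Real.log m := by
  have e1 := hA.1.det_eq_prod_eigenvalues
  have e2 := hA.1.trace_eq_sum_eigenvalues
  simp only [RCLike.ofReal_real_eq_id, id] at e1 e2
  rw [e1, Real.log_prod (fun i _ => (hA.eigenvalues_pos i).ne')]
  have : ∀ i ∈ Finset.univ, Real.log (hA.1.eigenvalues i) ≤
      Real.log m + (hA.1.eigenvalues i / m - 1) := by
    intro i _
    have hp := hA.eigenvalues_pos i
    have := Real.log_le_sub_one_of_pos (div_pos hp hm)
    rw [Real.log_div hp.ne' hm.ne'] at this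
    linarith
  refine (Finset.sum_le_sum this).trans ?_
  rw [Finset.sum_add_distrib, Finset.sum_sub_distrib, ← Finset.sum_div, ← e2]
  have : A.trace / m ≤ d := by rw [div_le_iff₀ hm]; exact h
  simp
  linarith


theorem stmt10 (d T : ℕ) (hd : 1 ≤ d) (hT : 1 ≤ T)
    (Φ : ℝ) (hΦ : 0 < Φ)
    (φ : ℕ → Fin d → ℝ) (hφ : ∀ t < T, Real.sqrt (φ t ⬝ᵥ φ t) ≤ Φ)
    (lam : ℝ) (hlam : 0 < lam) (hlamΦ : Φ ^ 2 ≤ lam) :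
    ∑ t ∈ Finset.range T,
        Real.sqrt (φ t ⬝ᵥ
          (lam • (1 : Matrix (Fin d) (Fin d) ℝ) +
            ∑ i ∈ Finset.range t, vecMulVec (φ i) (φ i))⁻¹.mulVec (φ t)) ≤
      Real.sqrt (2 * d * T * Real.log (1 + T * Φ ^ 2 / (lam * d))) := by
  have hd0 : (0 : ℝ) < d := by exact_mod_cast hd
  have hn : ∀ t < T, φ t ⬝ᵥ φ t ≤ Φ ^ 2 := fun t ht =>
    (Real.sqrt_le_left hΦ.le).1 (hφ t ht)
  obtain ⟨S, hS⟩ : ∃ S : ℕ → Matrix (Fin d) (Fin d) ℝ, ∀ t, S t =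
    lam • (1 : Matrix (Fin d) (Fin d) ℝ) + ∑ i ∈ Finset.range t, vecMulVec (φ i) (φ i) :=
    ⟨_, fun _ => rfl⟩
  simp only [← hS]
  have hpd : ∀ t, (S t).PosDef := fun t => by rw [hS]; exact aux_posDef d φ lam hlam t
  have hu : ∀ t, IsUnit (S t).det := fun t => (hpd t).det_pos.ne'.isUnit
  obtain ⟨q, hq⟩ : ∃ q : ℕ → ℝ, ∀ t, q t = φ t ⬝ᵥ (S t)⁻¹.mulVec (φ t) := ⟨_, fun _ => rfl⟩
  simp only [← hq]
  have hq0 : ∀ t, 0 ≤ q t := fun t => by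
    rw [hq]; simpa using (hpd t).inv.posSemidef.dotProduct_mulVec_nonneg (φ t)
  have hq1 : ∀ t < T, q t ≤ 1 := by
    intro t ht
    set x := (S t)⁻¹.mulVec (φ t) with hx
    have hSx : (S t).mulVec x = φ t := by
      rw [hx, mulVec_mulVec, Matrix.mul_nonsing_inv _ (hu t), one_mulVec]
    have h1 := aux_quad d φ lam t x
    rw [← hS, hSx, dotProduct_comm, hx, ← hq t, ← hx] at h1
    have h2 : 0 ≤ ∑ i ∈ Finset.range t, (φ i ⬝ᵥ x) ^ 2 := Finset.sum_nonneg fun i _ => sq_nonneg _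
    have h3 : (q t) ^ 2 ≤ (φ t ⬝ᵥ φ t) * (x ⬝ᵥ x) := by
      rw [hq, ← hx]
      have := Finset.sum_mul_sq_le_sq_mul_sq Finset.univ (φ t) x
      simpa [dotProduct, sq] using this
    have h4 : 0 ≤ x ⬝ᵥ x := by
      simpa using dotProduct_star_self_nonneg x
    have h5 : (φ t ⬝ᵥ φ t) * (x ⬝ᵥ x) ≤ lam * (x ⬝ᵥ x) :=
      mul_le_mul_of_nonneg_right ((hn t ht).trans hlamΦ) h4
    nlinarith [hq0 t]
  have hlog : ∀ t < T, q t ≤ 2 * Real.log (1 + q t) := by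
    intro t ht
    have h := Real.le_log_one_add_of_nonneg (hq0 t)
    have h' : q t / 2 ≤ 2 * q t / (q t + 2) := by
      rw [div_le_div_iff₀ (by norm_num) (by linarith [hq0 t])]
      nlinarith [hq0 t, hq1 t ht]
    linarith
  have hdet : ∀ t, (S (t+1)).det = (S t).det * (1 + q t) := by
    intro t
    rw [hq, ← aux_det d _ (hu t), hS, hS, Finset.sum_range_succ, add_assoc]
  have htel : ∀ n, Real.log (S n).det = d * Real.log lam + ∑ t ∈ Finset.range n, Real.log (1 + q t) := by
    intro n
    induction n with
    | zero => simp [hS]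
    | succ n ih =>
      rw [hdet, Real.log_mul (hpd n).det_pos.ne' (by linarith [hq0 n]), ih, Finset.sum_range_succ,
        add_assoc]
  have htr : (S T).trace ≤ d * (lam + T * Φ ^ 2 / d) := by
    have : (S T).trace = lam * d + ∑ i ∈ Finset.range T, φ i ⬝ᵥ φ i := by
      rw [hS]; simp [Matrix.trace_sum, Matrix.trace_vecMulVec]
    have h2 : ∑ i ∈ Finset.range T, φ i ⬝ᵥ φ i ≤ ∑ i ∈ Finset.range T, Φ ^ 2 :=
      Finset.sum_le_sum fun i hi => hn i (Finset.mem_range.1 hi)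
    simp at h2
    have h3 : d * (lam + T * Φ ^ 2 / d) = lam * d + T * Φ ^ 2 := by field_simp
    linarith
  have hm : 0 < lam + T * Φ ^ 2 / d := by positivity
  have hl := aux_logdet d hd (S T) (hpd T) _ hm htr
  have hfac : lam + T * Φ ^ 2 / d = lam * (1 + T * Φ ^ 2 / (lam * d)) := by field_simp
  rw [htel, hfac, Real.log_mul hlam.ne' (by positivity)] at hl
  have hsum : ∑ t ∈ Finset.range T, q t ≤ 2 * (d * Real.log (1 + T * Φ ^ 2 / (lam * d))) := by
    calc _ ≤ ∑ t ∈ Finset.range T, 2 * Real.log (1 + q t) :=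
          Finset.sum_le_sum fun i hi => hlog i (Finset.mem_range.1 hi)
      _ = 2 * ∑ t ∈ Finset.range T, Real.log (1 + q t) := by rw [Finset.mul_sum]
      _ ≤ _ := by linarith
  apply Real.le_sqrt_of_sq_le
  have hcs := sq_sum_le_card_mul_sum_sq (s := Finset.range T) (f := fun t => Real.sqrt (q t))
  simp only [Real.sq_sqrt (hq0 _), Finset.card_range] at hcs
  refine hcs.trans ((mul_le_mul_of_nonneg_left hsum (Nat.cast_nonneg T)).trans_eq (by ring))
end

section
/- Let d ≥ 1, n ≥ 0, λ ≥ 0, Φ > 0, and let φ₁, …, φ_n ∈ ℝ^d satisfy ‖φ_i‖₂ ≤ Φ for all i. Then det(λ·I_d + Σ_{i=1}^n φ_i φ_iᵀ) ≤ (λ + n·Φ²/d)^d. -/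
open Finset Matrix

theorem stmt12 (d n : ℕ) (hd : 1 ≤ d)
    (lam : ℝ) (hlam : 0 ≤ lam)
    (Φ : ℝ) (hΦ : 0 < Φ)
    (φ : ℕ → Fin d → ℝ) (hφ : ∀ i < n, Real.sqrt (φ i ⬝ᵥ φ i) ≤ Φ) :
    (lam • (1 : Matrix (Fin d) (Fin d) ℝ) +
        ∑ i ∈ Finset.range n, vecMulVec (φ i) (φ i)).det ≤
      (lam + n * Φ ^ 2 / d) ^ d := by
  have hdpos : (0 : ℝ) < d := by exact_mod_cast hd
  set A := lam • (1 : Matrix (Fin d) (Fin d) ℝ) +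
        ∑ i ∈ Finset.range n, vecMulVec (φ i) (φ i) with hAdef
  have hA : A.PosSemidef := by
    refine (PosSemidef.one.smul hlam).add (posSemidef_sum _ fun i _ => ?_)
    simpa using posSemidef_vecMulVec_self_star (φ i)
  have htr : A.trace ≤ lam * d + n * Φ ^ 2 := by
    rw [hAdef, trace_add, trace_smul, trace_one, trace_sum]
    simp only [trace_vecMulVec, Fintype.card_fin, smul_eq_mul]
    have := Finset.sum_le_card_nsmul (Finset.range n) (fun i => φ i ⬝ᵥ φ i) (Φ ^ 2)
      (fun i hi => (Real.sqrt_le_left hΦ.le).1 (hφ i (Finset.mem_range.1 hi)))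
    simp only [Finset.card_range, nsmul_eq_mul] at this
    linarith
  have hdet := hA.isHermitian.det_eq_prod_eigenvalues
  have htrace := hA.isHermitian.trace_eq_sum_eigenvalues
  simp only [RCLike.ofReal_real_eq_id, id] at hdet htrace
  have hev := hA.eigenvalues_nonneg
  have h1 := Real.geom_mean_le_arith_mean_weighted Finset.univ (fun _ : Fin d => (d : ℝ)⁻¹)
    hA.isHermitian.eigenvalues (fun _ _ => by positivity) (by simp [hdpos.ne']) (fun i _ => hev i)
  rw [Real.finsetProd_rpow _ _ (fun i _ => hev i), ← Finset.mul_sum, ← hdet, ← htrace] at h1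
  have h0 : 0 ≤ A.det := hdet ▸ Finset.prod_nonneg fun i _ => hev i
  calc A.det = (A.det ^ ((d : ℝ)⁻¹)) ^ d := (Real.rpow_inv_natCast_pow h0 (by omega)).symm
    _ ≤ _ := by
      refine pow_le_pow_left₀ (Real.rpow_nonneg h0 _) (h1.trans ?_) d
      rw [inv_mul_le_iff₀ hdpos]
      calc _ ≤ _ := htr
        _ = _ := by field_simp
end
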